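/- Let Δ be an M,N-invariant set, viewed as a subset of ℤ. Then there are exactly N integers c with c ∉ Δ and c + N ∈ Δ, and exactly M integers c with c ∉ Δ and c + M ∈ Δ. (In the paper's language: a path tuple has exactly N cells containing north steps and exactly M cells containing east steps.) -/

import Mathlib

/-- The alphabet {0, 1, •}. -/
inductive Symb where
  | zero : Symb
  | one : Symb
  | bullet : Symb
deriving DecidableEq

/-- An `M,N`-invariant set: a subset of ℕ with finite complement,
closed under adding `M` and adding `N`. -/
def Invariant (M N : ℕ) (Δ : Set ℕ) : Prop :=
  {n : ℕ | n ∉ Δ}.Finite ∧ ∀ i ∈ Δ, i + M ∈ Δ ∧ i + N ∈ Δ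

/-- `c` is a north step of `Δ`: `c ∉ Δ` and `c + N ∈ Δ`. -/
def NorthStep (N : ℕ) (Δ : Set ℕ) (c : ℕ) : Prop := c ∉ Δ ∧ c + N ∈ Δ

/-- `c` is an east step of `Δ`: `c ∉ Δ` and `c + M ∈ Δ`. -/
def EastStep (M : ℕ) (Δ : Set ℕ) (c : ℕ) : Prop := c ∉ Δ ∧ c + M ∈ Δ

/-- `area Δ` is the number of `c ≥ M + N` with `c ∉ Δ`. -/
noncomputable def area (M N : ℕ) (Δ : Set ℕ) : ℕ := {c : ℕ | M + N ≤ c ∧ c ∉ Δ}.ncard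

/-- `pdinv Δ` is the number of pairs `(c, d)` with `c < d`, `M ≤ d < c + M`,
`c` a north step of `Δ`, and `d ∉ Δ`. -/
noncomputable def pdinv (M N : ℕ) (Δ : Set ℕ) : ℕ :=
  {p : ℕ × ℕ | p.1 < p.2 ∧ M ≤ p.2 ∧ p.2 < p.1 + M ∧ NorthStep N Δ p.1 ∧ p.2 ∉ Δ}.ncard

/-- `Δ` fits the pair of words `(v, w)`, where `v` has length `M` and `w` has length `N`. -/
def Fits (M N : ℕ) (Δ : Set ℕ) (v w : List Symb) : Prop :=
  v.length = M ∧ w.length = N ∧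
  (∀ (i : ℕ) (hi : i < v.length),
    (v.get ⟨i, hi⟩ = Symb.bullet ↔ i ∈ Δ) ∧
    (v.get ⟨i, hi⟩ = Symb.one ↔ NorthStep N Δ i) ∧
    (v.get ⟨i, hi⟩ = Symb.zero ↔ (i ∉ Δ ∧ i + N ∉ Δ))) ∧
  (∀ (i : ℕ) (hi : i < w.length),
    (w.get ⟨i, hi⟩ = Symb.bullet ↔ i ∈ Δ) ∧
    (w.get ⟨i, hi⟩ = Symb.one ↔ EastStep M Δ i) ∧
    (w.get ⟨i, hi⟩ = Symb.zero ↔ (i ∉ Δ ∧ i + M ∉ Δ)))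

/-- Decrement: `dec Δ = {i : ℕ | i + 1 ∈ Δ}`. -/
def dec (Δ : Set ℕ) : Set ℕ := {i : ℕ | i + 1 ∈ Δ}

/-- A set of nonnegative integers that misses only finitely many of them and is closed under
adding `n` is entered by the translation by `n` exactly `n` times: adjoining to the entering
points the gaps shifted down by `n` gives the same set as adjoining `[-n, 0)` to the gaps. -/
theorem ncard_steps_eq (n : ℕ) (D : Set ℤ) (hD : ∀ x ∈ D, 0 ≤ x)
    (hfin : {x : ℤ | 0 ≤ x ∧ x ∉ D}.Finite) (hadd : ∀ x ∈ D, x + n ∈ D) :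
    {c : ℤ | c ∉ D ∧ c + n ∈ D}.ncard = n := by
  set G : Set ℤ := {x : ℤ | 0 ≤ x ∧ x ∉ D} with hG
  set S : Set ℤ := {c : ℤ | c ∉ D ∧ c + n ∈ D} with hS
  have hunion : S ∪ (fun x : ℤ => x - n) '' G = Set.Ico (-(n : ℤ)) 0 ∪ G := by
    ext x
    simp only [hS, hG, Set.mem_union, Set.mem_ofPred_eq, Set.mem_image, Set.mem_Ico]
    constructor
    · rintro (⟨hx, hxn⟩ | ⟨y, ⟨hy, hyD⟩, rfl⟩)
      · have := hD _ hxn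
        by_cases h : 0 ≤ x
        · exact Or.inr ⟨h, hx⟩
        · exact Or.inl ⟨by omega, by omega⟩
      · by_cases h : 0 ≤ y - n
        · refine Or.inr ⟨h, fun hmem => hyD ?_⟩
          simpa using hadd _ hmem
        · exact Or.inl ⟨by omega, by omega⟩
    · intro hx
      have hxD : x ∉ D := by
        rcases hx with hx | hx
        · exact fun hmem => by have := hD _ hmem; omega
        · exact hx.2
      by_cases h : x + n ∈ D
      · exact Or.inl ⟨hxD, h⟩
      · exact Or.inr ⟨x + n, ⟨by omega, h⟩, by ring⟩
  have hSfin : S.Finite :=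
    ((Set.finite_Ico _ _).union hfin).subset (hunion ▸ Set.subset_union_left)
  have hdisj₁ : Disjoint S ((fun x : ℤ => x - n) '' G) := by
    rw [Set.disjoint_left]
    rintro _ ⟨_, hxn⟩ ⟨y, ⟨_, hyD⟩, rfl⟩
    exact hyD (by simpa using hxn)
  have hdisj₂ : Disjoint (Set.Ico (-(n : ℤ)) 0) G := by
    rw [Set.disjoint_left]
    rintro x ⟨_, hx⟩ ⟨hx', _⟩
    omega
  have hcard := congrArg Set.ncard hunion
  rw [Set.ncard_union_eq hdisj₁ hSfin (hfin.image _),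
    Set.ncard_union_eq hdisj₂ (Set.finite_Ico _ _) hfin,
    Set.ncard_image_of_injective _ sub_left_injective] at hcard
  have hIco : (Set.Ico (-(n : ℤ)) 0).ncard = n := by
    rw [← Finset.coe_Ico, Set.ncard_coe_finset]
    simp
  omega

/-- Viewing an `M,N`-invariant set `Δ` as a subset of ℤ, there are exactly
`N` integers `c` with `c ∉ Δ` and `c + N ∈ Δ`, and exactly `M` integers `c` with `c ∉ Δ`
and `c + M ∈ Δ`. -/
theorem north_east_step_counts (M N : ℕ) (hM : 0 < M) (hN : 0 < N)
    (Δ : Set ℕ) (hΔ : Invariant M N Δ) :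
    {c : ℤ | c ∉ ((fun a : ℕ => (a : ℤ)) '' Δ) ∧
      c + (N : ℤ) ∈ ((fun a : ℕ => (a : ℤ)) '' Δ)}.ncard = N ∧
    {c : ℤ | c ∉ ((fun a : ℕ => (a : ℤ)) '' Δ) ∧
      c + (M : ℤ) ∈ ((fun a : ℕ => (a : ℤ)) '' Δ)}.ncard = M := by
  have hnonneg : ∀ x ∈ (fun a : ℕ => (a : ℤ)) '' Δ, 0 ≤ x := by
    rintro _ ⟨a, _, rfl⟩
    exact Int.natCast_nonneg a
  have hfin : {x : ℤ | 0 ≤ x ∧ x ∉ (fun a : ℕ => (a : ℤ)) '' Δ}.Finite := by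
    refine (hΔ.1.image fun a : ℕ => (a : ℤ)).subset ?_
    rintro x ⟨hx, hxΔ⟩
    lift x to ℕ using hx
    exact ⟨x, fun h => hxΔ ⟨x, h, rfl⟩, rfl⟩
  refine ⟨ncard_steps_eq N _ hnonneg hfin ?_, ncard_steps_eq M _ hnonneg hfin ?_⟩
  · rintro _ ⟨a, ha, rfl⟩
    exact ⟨a + N, (hΔ.2 a ha).2, by simp⟩
  · rintro _ ⟨a, ha, rfl⟩
    exact ⟨a + M, (hΔ.2 a ha).1, by simp⟩
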